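/- (Price of Stability at most 2 − 1/m for symmetric games) Every symmetric SCG with m strategies has a Nash equilibrium s such that (2 − 1/m)·u(s) ≥ u(s') for every strategy vector s'. -/

import Mathlib

open Finset

/-- A social coordination game (SCG): intrinsic weights `w i k`, symmetric nonnegative
coordination weights `cw i j`, and sharing coefficients `gam i j` with
`gam i j + gam j i = 1` for distinct players. -/
structure SCG (N M : Type*) [Fintype N] [DecidableEq N] [Fintype M] [DecidableEq M] where
  w : N → M → ℝ
  cw : N → N → ℝ
  gam : N → N → ℝ
  w_nonneg : ∀ i k, 0 ≤ w i k
  cw_nonneg : ∀ i j, 0 ≤ cw i j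
  cw_symm : ∀ i j, cw i j = cw j i
  gam_nonneg : ∀ i j, 0 ≤ gam i j
  gam_sum : ∀ i j, i ≠ j → gam i j + gam j i = 1

namespace SCG

variable {N M : Type*} [Fintype N] [DecidableEq N] [Fintype M] [DecidableEq M]

/-- Player `i`'s utility under strategy vector `s`. -/
def util (G : SCG N M) (s : N → M) (i : N) : ℝ :=
  G.w i (s i) + ∑ j ∈ univ.filter (fun j => j ≠ i ∧ s j = s i), G.gam i j * G.cw i j

/-- Social welfare of a strategy vector. -/
def welfare (G : SCG N M) (s : N → M) : ℝ := ∑ i, G.util s i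

/-- Pure Nash equilibrium. -/
def NashEq (G : SCG N M) (s : N → M) : Prop :=
  ∀ (i : N) (k : M), G.util (Function.update s i k) i ≤ G.util s i

/-- `α`-approximate equilibrium. -/
def ApproxEq (G : SCG N M) (α : ℝ) (s : N → M) : Prop :=
  ∀ (i : N) (k : M), G.util (Function.update s i k) i ≤ α * G.util s i

/-- The coordination payoff that `i` receives from `j` when the weight of the pair is shared
equally. -/
noncomputable def halfShare (G : SCG N M) (s : N → M) (i j : N) : ℝ :=
  if j ≠ i ∧ s j = s i then G.cw i j / 2 else 0

/-- The exact potential of a symmetric SCG: the intrinsic weights, plus half of the total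
weight of the coordinating pairs. -/
noncomputable def potential (G : SCG N M) (s : N → M) : ℝ :=
  ∑ i, G.w i (s i) + (∑ i, ∑ j, G.halfShare s i j) / 2

theorem halfShare_nonneg (G : SCG N M) (s : N → M) (i j : N) : 0 ≤ G.halfShare s i j := by
  unfold halfShare
  split_ifs
  · exact div_nonneg (G.cw_nonneg i j) zero_le_two
  · exact le_rfl

theorem halfShare_self (G : SCG N M) (s : N → M) (i : N) : G.halfShare s i i = 0 := by
  simp [halfShare]

theorem halfShare_comm (G : SCG N M) (s : N → M) (i j : N) :
    G.halfShare s i j = G.halfShare s j i := by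
  simp only [halfShare, G.cw_symm i j, ne_comm (a := j), eq_comm (a := s j)]

theorem halfShare_le_const (G : SCG N M) (s : N → M) (k : M) (i j : N) :
    G.halfShare s i j ≤ G.halfShare (fun _ => k) i j := by
  by_cases h : j ≠ i ∧ s j = s i
  · simp [halfShare, h]
  · rw [halfShare, if_neg h]
    exact G.halfShare_nonneg _ i j

theorem util_eq_of_symmetric (G : SCG N M) (hsym : ∀ i j : N, i ≠ j → G.gam i j = 1 / 2)
    (s : N → M) (i : N) : G.util s i = G.w i (s i) + ∑ j, G.halfShare s i j := by
  rw [util, sum_filter]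
  congr 1
  refine sum_congr rfl fun j _ => ?_
  unfold halfShare
  split_ifs with h
  · rw [hsym i j h.1.symm]
    ring
  · rfl

theorem welfare_eq_of_symmetric (G : SCG N M) (hsym : ∀ i j : N, i ≠ j → G.gam i j = 1 / 2)
    (s : N → M) : G.welfare s = ∑ i, G.w i (s i) + ∑ i, ∑ j, G.halfShare s i j := by
  simp only [welfare, G.util_eq_of_symmetric hsym, sum_add_distrib]

/-- The potential splits into the utility of `i` and a part that ignores the strategy of `i`. -/
theorem potential_eq_util_add (G : SCG N M)
    (hsym : ∀ i j : N, i ≠ j → G.gam i j = 1 / 2) (s : N → M) (i : N) :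
    G.potential s = G.util s i + (∑ a ∈ univ.erase i, G.w a (s a) +
      (∑ a ∈ univ.erase i, ∑ b ∈ univ.erase i, G.halfShare s a b) / 2) := by
  have hcol : ∑ a ∈ univ.erase i, G.halfShare s a i = ∑ j, G.halfShare s i j := by
    rw [← add_sum_erase univ (G.halfShare s i) (mem_univ i), halfShare_self, zero_add]
    exact sum_congr rfl fun a _ => G.halfShare_comm s a i
  have hdouble : ∑ a, ∑ b, G.halfShare s a b = 2 * ∑ j, G.halfShare s i j +
      ∑ a ∈ univ.erase i, ∑ b ∈ univ.erase i, G.halfShare s a b := by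
    have hrow : ∑ a ∈ univ.erase i, ∑ b, G.halfShare s a b =
        ∑ a ∈ univ.erase i, (G.halfShare s a i + ∑ b ∈ univ.erase i, G.halfShare s a b) :=
      sum_congr rfl fun a _ => (add_sum_erase univ _ (mem_univ i)).symm
    rw [← add_sum_erase univ (fun a => ∑ b, G.halfShare s a b) (mem_univ i), hrow,
      sum_add_distrib, hcol]
    ring
  rw [potential, hdouble, G.util_eq_of_symmetric hsym,
    ← add_sum_erase univ (fun a => G.w a (s a)) (mem_univ i)]
  ring

theorem potential_update_sub (G : SCG N M)
    (hsym : ∀ i j : N, i ≠ j → G.gam i j = 1 / 2) (s : N → M) (i : N) (k : M) :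
    G.potential (Function.update s i k) - G.potential s =
      G.util (Function.update s i k) i - G.util s i := by
  have hw : ∑ a ∈ univ.erase i, G.w a (Function.update s i k a) =
      ∑ a ∈ univ.erase i, G.w a (s a) :=
    sum_congr rfl fun a ha => by rw [Function.update_of_ne (ne_of_mem_erase ha)]
  have hc : ∑ a ∈ univ.erase i, ∑ b ∈ univ.erase i, G.halfShare (Function.update s i k) a b =
      ∑ a ∈ univ.erase i, ∑ b ∈ univ.erase i, G.halfShare s a b :=
    sum_congr rfl fun a ha => sum_congr rfl fun b hb => by
      rw [halfShare, halfShare, Function.update_of_ne (ne_of_mem_erase ha),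
        Function.update_of_ne (ne_of_mem_erase hb)]
  rw [G.potential_eq_util_add hsym _ i, G.potential_eq_util_add hsym s i, hw, hc]
  ring

theorem nashEq_of_potential_le (G : SCG N M)
    (hsym : ∀ i j : N, i ≠ j → G.gam i j = 1 / 2) {s : N → M}
    (hs : ∀ t, G.potential t ≤ G.potential s) : G.NashEq s := fun i k => by
  linarith [hs (Function.update s i k), G.potential_update_sub hsym s i k]

/-- Averaging over the constant strategy vectors: a maximum of the potential is at least
a `1/m` fraction of any intrinsic welfare plus half of any coordination welfare. -/
theorem le_potential_of_forall_const [Nonempty M] (G : SCG N M) {x : ℝ}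
    (hx : ∀ k : M, G.potential (fun _ => k) ≤ x) (s t : N → M) :
    1 / (Fintype.card M : ℝ) * ∑ i, G.w i (s i) + (∑ i, ∑ j, G.halfShare t i j) / 2 ≤ x := by
  have hm : (0 : ℝ) < Fintype.card M := by exact_mod_cast Fintype.card_pos
  have hk : ∀ k : M, ∑ i, G.w i k ≤ x - (∑ i, ∑ j, G.halfShare t i j) / 2 := fun k => by
    have hle : ∑ i, ∑ j, G.halfShare t i j ≤ ∑ i, ∑ j, G.halfShare (fun _ => k) i j :=
      sum_le_sum fun i _ => sum_le_sum fun j _ => G.halfShare_le_const t k i j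
    have h := hx k
    rw [potential] at h
    linarith
  have hsum : ∑ i, G.w i (s i) ≤
      Fintype.card M * (x - (∑ i, ∑ j, G.halfShare t i j) / 2) :=
    calc ∑ i, G.w i (s i) ≤ ∑ i, ∑ k, G.w i k :=
          sum_le_sum fun i _ => single_le_sum (fun k _ => G.w_nonneg i k) (mem_univ (s i))
      _ = ∑ k, ∑ i, G.w i k := sum_comm
      _ ≤ ∑ _k : M, (x - (∑ i, ∑ j, G.halfShare t i j) / 2) := sum_le_sum fun k _ => hk k
      _ = _ := by rw [sum_const, card_univ, nsmul_eq_mul]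
  have hdiv := (div_le_iff₀' hm).2 hsum
  rw [one_div_mul_eq_div]
  linarith

/-- Price of Stability at most `2 - 1/m` for symmetric SCGs: there is a Nash equilibrium
whose social welfare is at least a fraction `1/(2 - 1/m)` of every strategy vector's. -/
theorem pos_symmetric [Nonempty N] [Nonempty M] (G : SCG N M)
    (hsym : ∀ i j : N, i ≠ j → G.gam i j = 1 / 2) :
    ∃ s : N → M, G.NashEq s ∧
      ∀ s' : N → M, G.welfare s' ≤ (2 - 1 / (Fintype.card M : ℝ)) * G.welfare s := by
  obtain ⟨s, hs⟩ := Finite.exists_max G.potential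
  refine ⟨s, G.nashEq_of_potential_le hsym hs, fun t => ?_⟩
  have havg := G.le_potential_of_forall_const (fun k => hs fun _ => k) s t
  have hst := hs t
  have hnonneg : 0 ≤ ∑ i, ∑ j, G.halfShare s i j :=
    sum_nonneg fun i _ => sum_nonneg fun j _ => G.halfShare_nonneg s i j
  have hm : 1 / (Fintype.card M : ℝ) ≤ 1 := by
    rw [one_div]
    exact inv_le_one_of_one_le₀ (by exact_mod_cast Fintype.card_pos (α := M))
  rw [G.welfare_eq_of_symmetric hsym, G.welfare_eq_of_symmetric hsym]
  simp only [potential] at hst havg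
  nlinarith [mul_nonneg (sub_nonneg.2 hm) hnonneg]

end SCG
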